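/- Let (J,𝓑,η) be a k-loose Markov space. Then every finite simple graph of girth at least 5 (containing no cycle of length 3 or 4) with maximum degree at most k is well-measured in η. -/

import Mathlib

open MeasureTheory ProbabilityTheory Finset
open scoped ENNReal

variable {V : Type*} [DecidableEq V] {J : Type*} [MeasurableSpace J]

/-- Restriction of a map `↥T → J` to a subset `S ⊆ T` of a finset `T`. -/
def restr (S T : Finset V) (h : S ⊆ T) (x : ↥T → J) : ↥S → J :=
  fun v => x ⟨v.1, h v.2⟩

/-- A family of σ-finite measures `μ S` on `J^S` (for `S ⊆ V`) is a *normalized, decreasing,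
Markovian family* for the graph `G` and the symmetric measure `η` (with marginal
`π = η ∘ fst⁻¹`) if:
* (normalized) `μ {v} = π` for each vertex and `μ {u,v} = η` (under `J^{u,v} ≅ J²`) for each
  edge `uv` of `G`;
* (decreasing) for `S ⊆ T` the marginal of `μ T` on `J^S` is absolutely continuous w.r.t. `μ S`;
* (Markovian) there are disintegration kernels `ν S T : J^S ⤳ J^{T∖S}` of `μ T` over `μ S`
  such that whenever `U, W ⊆ V`, `S = U ∩ W` and no edge of `G` joins `U ∖ S` to `W ∖ S`,
  one has `ν S (U∪W) x = ν S U x × ν S W x` for `μ S`-almost all `x`. -/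
def IsHomMeasureFamily [Fintype V] (G : SimpleGraph V) (η : Measure (J × J))
    (μ : (S : Finset V) → Measure (↥S → J)) : Prop :=
  (∀ S, SigmaFinite (μ S)) ∧
  (∀ v : V, μ {v} = (η.map Prod.fst).map (fun j (_ : ↥({v} : Finset V)) => j)) ∧
  (∀ u v : V, G.Adj u v →
      μ {u, v} = η.map (fun q (w : ↥({u, v} : Finset V)) => if (w : V) = u then q.1 else q.2)) ∧
  (∀ (S T : Finset V) (h : S ⊆ T), (μ T).map (restr S T h) ≪ μ S) ∧
  (∃ ν : (S : Finset V) → (T : Finset V) → S ⊆ T → Kernel (↥S → J) (↥(T \ S) → J),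
    (∀ (S T : Finset V) (h : S ⊆ T) (A : Set (↥S → J)) (B : Set (↥(T \ S) → J)),
        MeasurableSet A → MeasurableSet B →
        μ T {x | restr S T h x ∈ A ∧ restr (T \ S) T sdiff_subset x ∈ B}
          = ∫⁻ x in A, ν S T h x B ∂(μ S)) ∧
    (∀ U W : Finset V,
        (∀ u ∈ U \ (U ∩ W), ∀ w ∈ W \ (U ∩ W), ¬ G.Adj u w) →
        ∀ᵐ x ∂(μ (U ∩ W)),
          (ν (U ∩ W) (U ∪ W) inter_subset_union x).map
            (fun y => (restr (U \ (U ∩ W)) ((U ∪ W) \ (U ∩ W))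
                          (sdiff_subset_sdiff subset_union_left le_rfl) y,
                       restr (W \ (U ∩ W)) ((U ∪ W) \ (U ∩ W))
                          (sdiff_subset_sdiff subset_union_right le_rfl) y))
            = (ν (U ∩ W) U inter_subset_left x).prod (ν (U ∩ W) W inter_subset_right x)))

/-- A finite simple graph `G` is *well-measured* in the Markov space `η` if a normalized,
decreasing, Markovian family of σ-finite measures exists. -/
def WellMeasured [Fintype V] (G : SimpleGraph V) (η : Measure (J × J)) : Prop :=
  ∃ μ : (S : Finset V) → Measure (↥S → J), IsHomMeasureFamily G η μ

/-- `G` is well-measured in `η` *with finite density* if moreover the witnessing family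
consists of finite measures. -/
def WellMeasuredFinite [Fintype V] (G : SimpleGraph V) (η : Measure (J × J)) : Prop :=
  ∃ μ : (S : Finset V) → Measure (↥S → J),
    IsHomMeasureFamily G η μ ∧ ∀ S, IsFiniteMeasure (μ S)

/-- The joint law `σ_k` of `k` independent single steps of the kernel `P`, started from a
common `π`-random point. -/
noncomputable def stepMeasure (π : Measure J) (P : Kernel J J) (k : ℕ) :
    Measure (Fin k → J) :=
  π.bind fun x => Measure.pi fun _ : Fin k => P x

/-- `k`-looseness: `σ_k ≪ π^k`. -/
def KLoose (π : Measure J) (P : Kernel J J) (k : ℕ) : Prop :=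
  stepMeasure π P k ≪ Measure.pi fun _ : Fin k => π

/-- The image of a product of copies of a probability measure under reindexing along an injection
is again a product of copies of this measure. -/
lemma pi_map_comp_injective {ι κ : Type*} [Fintype ι] [Fintype κ] (m : Measure J)
    [IsProbabilityMeasure m] {e : ι → κ} (he : Function.Injective e) :
    (Measure.pi fun _ : κ => m).map (fun x i => x (e i)) = Measure.pi fun _ : ι => m := by
  have h : iIndepFun (fun (j : κ) (x : κ → J) => x j) (Measure.pi fun _ : κ => m) :=
    iIndepFun_pi (X := fun _ => id) fun _ => aemeasurable_id
  have h' := h.precomp he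
  rw [iIndepFun_iff_map_fun_eq_pi_map (fun i => (measurable_pi_apply (e i)).aemeasurable)] at h'
  refine h'.trans ?_
  congr 1
  ext1 i
  exact (measurePreserving_eval (fun _ : κ => m) (e i)).map_eq

lemma lintegral_pi_prod {ι : Type*} [Fintype ι] (m : ι → Measure J)
    [∀ i, IsProbabilityMeasure (m i)] {g : ι → J → ℝ≥0∞} (hg : ∀ i, Measurable (g i)) :
    ∫⁻ x, ∏ i, g i (x i) ∂(Measure.pi m) = ∏ i, ∫⁻ a, g i a ∂(m i) := by
  rw [lintegral_prod_eq_prod_lintegral_of_indepFun univ (fun i (x : ι → J) => g i (x i))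
    (iIndepFun_pi fun i => (hg i).aemeasurable)
    (fun i => (hg i).comp (measurable_pi_apply i))]
  refine Finset.prod_congr rfl fun i _ => ?_
  rw [← (measurePreserving_eval m i).map_eq, lintegral_map (hg i) (measurable_pi_apply i)]

/-- The kernel of independent steps of `P`, indexed by `ι`, from a common starting point. -/
noncomputable def piKernel (P : Kernel J J) [IsMarkovKernel P] (ι : Type*) [Fintype ι] :
    Kernel J (ι → J) where
  toFun a := Measure.pi fun _ => P a
  measurable' := by
    refine Measurable.measure_of_isPiSystem_of_isProbabilityMeasure generateFrom_pi.symm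
      isPiSystem_pi ?_
    rintro _ ⟨s, hs, rfl⟩
    simp only [Measure.pi_pi]
    exact Finset.measurable_prod _ fun i _ => P.measurable_coe (hs i (Set.mem_univ i))

lemma piKernel_apply (P : Kernel J J) [IsMarkovKernel P] (ι : Type*) [Fintype ι] (a : J) :
    piKernel P ι a = Measure.pi fun _ => P a := rfl

instance (P : Kernel J J) [IsMarkovKernel P] (ι : Type*) [Fintype ι] :
    IsMarkovKernel (piKernel P ι) :=
  ⟨fun a => by rw [piKernel_apply]; infer_instance⟩

/-- The joint law of the leaves and the centre of a star whose centre has law `π` and whose leaves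
are independent steps of `P` from the centre. -/
noncomputable def starMeasure (π : Measure J) (P : Kernel J J) [IsMarkovKernel P]
    (ι : Type*) [Fintype ι] : Measure ((ι → J) × J) :=
  (π ⊗ₘ piKernel P ι).map Prod.swap

instance (π : Measure J) [IsProbabilityMeasure π] (P : Kernel J J) [IsMarkovKernel P]
    (ι : Type*) [Fintype ι] : IsProbabilityMeasure (starMeasure π P ι) :=
  Measure.isProbabilityMeasure_map measurable_swap.aemeasurable

lemma lintegral_starMeasure (π : Measure J) [IsProbabilityMeasure π] (P : Kernel J J)
    [IsMarkovKernel P] (ι : Type*) [Fintype ι] {f : (ι → J) × J → ℝ≥0∞} (hf : Measurable f) :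
    ∫⁻ z, f z ∂(starMeasure π P ι) =
      ∫⁻ a, ∫⁻ x, f (x, a) ∂(Measure.pi fun _ : ι => P a) ∂π := by
  rw [starMeasure, lintegral_map hf measurable_swap,
    Measure.lintegral_compProd (f := fun z => f z.swap) (hf.comp measurable_swap)]
  rfl

lemma starMeasure_fst_absolutelyContinuous {π : Measure J} [IsProbabilityMeasure π]
    {P : Kernel J J} [IsMarkovKernel P] {k : ℕ} (h : KLoose π P k) {ι : Type*} [Fintype ι]
    (hι : Fintype.card ι ≤ k) :
    (starMeasure π P ι).fst ≪ Measure.pi fun _ : ι => π := by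
  obtain ⟨e⟩ : Nonempty (ι ↪ Fin k) := Function.Embedding.nonempty_of_card_le (by simpa using hι)
  have hm : Measurable fun (x : Fin k → J) (i : ι) => x (e i) := by fun_prop
  refine Measure.AbsolutelyContinuous.mk fun s hs h0 => ?_
  rw [← pi_map_comp_injective π e.injective, Measure.map_apply hm hs] at h0
  have h1 := h h0
  change (piKernel P (Fin k) ∘ₘ π) _ = 0 at h1
  rw [Measure.bind_apply (hm hs) (piKernel P (Fin k)).measurable.aemeasurable] at h1
  rw [Measure.fst_apply hs, ← lintegral_indicator_one (measurable_fst hs),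
    lintegral_starMeasure _ _ _ (measurable_one.indicator (measurable_fst hs)), ← h1]
  refine lintegral_congr fun a => ?_
  rw [← Measure.map_apply hm hs, piKernel_apply, pi_map_comp_injective (P a) e.injective,
    ← lintegral_indicator_one hs]
  rfl

/-- The density of the law of the leaves of a star with respect to `π^ι`. -/
noncomputable def starDensity (π : Measure J) (P : Kernel J J) [IsMarkovKernel P]
    (ι : Type*) [Fintype ι] (x : ι → J) : NNReal :=
  ((starMeasure π P ι).fst.rnDeriv (Measure.pi fun _ : ι => π) x).toNNReal

lemma measurable_starDensity (π : Measure J) (P : Kernel J J) [IsMarkovKernel P]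
    (ι : Type*) [Fintype ι] : Measurable (starDensity π P ι) :=
  (Measure.measurable_rnDeriv _ _).ennreal_toNNReal

/-- The disintegration of the star measure with respect to the product measure `π^ι` on its
leaves. -/
noncomputable def starKernel [StandardBorelSpace J] [Nonempty J] (π : Measure J)
    [IsProbabilityMeasure π] (P : Kernel J J) [IsMarkovKernel P] (ι : Type*) [Fintype ι] :
    Kernel (ι → J) J :=
  (starMeasure π P ι).condKernel.withDensity fun x _ => starDensity π P ι x

section starKernel

variable [StandardBorelSpace J] [Nonempty J] (π : Measure J) [IsProbabilityMeasure π]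
  (P : Kernel J J) [IsMarkovKernel P] (ι : Type*) [Fintype ι]

instance : IsSFiniteKernel (starKernel π P ι) := by
  unfold starKernel; infer_instance

lemma starKernel_apply (x : ι → J) :
    starKernel π P ι x = (starDensity π P ι x : ℝ≥0∞) • (starMeasure π P ι).condKernel x := by
  rw [starKernel, Kernel.withDensity_apply _ (by
    have := measurable_starDensity π P ι
    fun_prop), withDensity_const]

lemma starKernel_univ_ne_top (x : ι → J) : starKernel π P ι x Set.univ ≠ ∞ := by
  simp [starKernel_apply]

variable {π P ι}

lemma lintegral_starKernel {k : ℕ} (h : KLoose π P k) (hι : Fintype.card ι ≤ k)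
    {f : (ι → J) × J → ℝ≥0∞} (hf : Measurable f) :
    ∫⁻ x, ∫⁻ a, f (x, a) ∂(starKernel π P ι x) ∂(Measure.pi fun _ : ι => π) =
      ∫⁻ a, ∫⁻ x, f (x, a) ∂(Measure.pi fun _ : ι => P a) ∂π := by
  rw [← lintegral_starMeasure π P ι hf, ← (starMeasure π P ι).disintegrate
    (starMeasure π P ι).condKernel, Measure.lintegral_compProd hf,
    ← Measure.withDensity_rnDeriv_eq _ _ (starMeasure_fst_absolutelyContinuous h hι),
    lintegral_withDensity_eq_lintegral_mul _ (Measure.measurable_rnDeriv _ _)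
      hf.lintegral_kernel_prod_right']
  refine lintegral_congr_ae ?_
  filter_upwards [Measure.rnDeriv_lt_top (starMeasure π P ι).fst (Measure.pi fun _ : ι => π)]
    with x hx
  rw [starKernel_apply, lintegral_smul_measure, starDensity, ENNReal.coe_toNNReal hx.ne]
  rfl

end starKernel

lemma lintegral_pi_split [Fintype V] (m : Measure J) [IsProbabilityMeasure m] (N : Finset V)
    {F : (V → J) → ℝ≥0∞} (hF : Measurable F) :
    ∫⁻ x, F x ∂(Measure.pi fun _ : V => m) =
      ∫⁻ z, ∫⁻ y, F ((MeasurableEquiv.piEquivPiSubtypeProd (fun _ : V => J) (· ∈ N)).symm (y, z))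
        ∂(Measure.pi fun _ : {w // w ∈ N} => m) ∂(Measure.pi fun _ : {w // w ∉ N} => m) := by
  have h := (measurePreserving_piEquivPiSubtypeProd (fun _ : V => m) (· ∈ N)).symm
  rw [← h.map_eq, lintegral_map hF (MeasurableEquiv.measurable _), lintegral_prod_symm]
  · congr!
  exact (hF.comp
    (MeasurableEquiv.piEquivPiSubtypeProd (fun _ : V => J) (· ∈ N)).symm.measurable).aemeasurable

lemma piEquivPiSubtypeProd_symm_of_mem {N : Finset V} (y : {w // w ∈ N} → J)
    (z : {w // w ∉ N} → J) {w : V} (hw : w ∈ N) :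
    (MeasurableEquiv.piEquivPiSubtypeProd (fun _ : V => J) (· ∈ N)).symm (y, z) w = y ⟨w, hw⟩ :=
  dif_pos hw

lemma piEquivPiSubtypeProd_symm_of_notMem {N : Finset V} (y : {w // w ∈ N} → J)
    (z : {w // w ∉ N} → J) {w : V} (hw : w ∉ N) :
    (MeasurableEquiv.piEquivPiSubtypeProd (fun _ : V => J) (· ∈ N)).symm (y, z) w = z ⟨w, hw⟩ :=
  dif_neg hw

lemma measurable_update_prod (v : V) :
    Measurable fun p : (V → J) × J => Function.update p.1 v p.2 := by
  refine measurable_pi_lambda _ fun w => ?_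
  by_cases h : w = v
  · subst h; simpa using measurable_snd
  · simp only [Function.update_of_ne h]
    fun_prop

lemma map_update_pi [Fintype V] (m : Measure J) [IsProbabilityMeasure m] (v : V) :
    ((Measure.pi fun _ : V => m).prod m).map (fun p => Function.update p.1 v p.2) =
      Measure.pi fun _ : V => m := by
  symm
  refine Measure.pi_eq fun s hs => ?_
  rw [Measure.map_apply (measurable_update_prod v) (MeasurableSet.univ_pi hs)]
  have : (fun p : (V → J) × J => Function.update p.1 v p.2) ⁻¹' Set.univ.pi s =
      Set.univ.pi (Function.update s v Set.univ) ×ˢ s v := by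
    ext ⟨x, a⟩
    simp only [Set.mem_preimage, Set.mem_pi, Set.mem_univ, true_imp_iff, Set.mem_prod]
    constructor
    · intro h
      refine ⟨fun w => ?_, by simpa using h v⟩
      by_cases hw : w = v
      · subst hw; simp
      · simpa [hw] using h w
    · rintro ⟨h1, h2⟩ w
      by_cases hw : w = v
      · subst hw; simpa using h2
      · simpa [hw] using h1 w
  rw [this, Measure.prod_prod, Measure.pi_pi, ← Finset.mul_prod_erase univ _ (Finset.mem_univ v),
    ← Finset.mul_prod_erase univ (fun w => m (s w)) (Finset.mem_univ v), mul_comm]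
  simp only [Function.update_self, measure_univ, one_mul]
  congr 1
  refine Finset.prod_congr rfl fun w hw => ?_
  rw [Function.update_of_ne (Finset.ne_of_mem_erase hw)]

lemma lintegral_update_pi [Fintype V] (m : Measure J) [IsProbabilityMeasure m] (v : V)
    {F : (V → J) → ℝ≥0∞} (hF : Measurable F) :
    ∫⁻ a, ∫⁻ x, F (Function.update x v a) ∂(Measure.pi fun _ : V => m) ∂m =
      ∫⁻ x, F x ∂(Measure.pi fun _ : V => m) := by
  conv_rhs => rw [← map_update_pi m v]
  rw [lintegral_map hF (measurable_update_prod v), lintegral_prod_symm]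
  exact (hF.comp (measurable_update_prod v)).aemeasurable

section localKernel

variable [StandardBorelSpace J] [Nonempty J] (π : Measure J) [IsProbabilityMeasure π]
  (P : Kernel J J) [IsMarkovKernel P]

/-- The star kernel with leaves in `N`, reading the leaves off a configuration on `V`. -/
noncomputable def localKernel (N : Finset V) : Kernel (V → J) J :=
  (starKernel π P N).comap N.restrict (Finset.measurable_restrict N)

instance (N : Finset V) : IsSFiniteKernel (localKernel π P N) := by
  unfold localKernel; infer_instance

omit [DecidableEq V] in
lemma localKernel_apply (N : Finset V) (x : V → J) :
    localKernel π P N x = starKernel π P N (N.restrict x) := rfl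

omit [DecidableEq V] in
variable {π P} in
lemma localKernel_congr {N : Finset V} {x x' : V → J} (h : ∀ w ∈ N, x w = x' w) :
    localKernel π P N x = localKernel π P N x' := by
  rw [localKernel_apply, localKernel_apply]
  congr 1
  ext ⟨w, hw⟩
  exact h w hw

omit [DecidableEq V] in
lemma localKernel_univ_ne_top (N : Finset V) (x : V → J) :
    localKernel π P N x Set.univ ≠ ∞ :=
  starKernel_univ_ne_top π P N _

variable {π P}

lemma lintegral_localKernel [Fintype V] {k : ℕ} (h : KLoose π P k) {N : Finset V}
    (hN : N.card ≤ k) {g : V → J → ℝ≥0∞} (hg : ∀ w, Measurable (g w))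
    {F : (V → J) → J → ℝ≥0∞} (hF : Measurable (Function.uncurry F))
    (hFN : ∀ x x' a, (∀ w ∉ N, x w = x' w) → F x a = F x' a) :
    ∫⁻ x, (∏ w ∈ N, g w (x w)) * ∫⁻ a, F x a ∂(localKernel π P N x)
        ∂(Measure.pi fun _ : V => π) =
      ∫⁻ a, (∏ w ∈ N, ∫⁻ b, g w b ∂(P a)) * ∫⁻ x, F x a ∂(Measure.pi fun _ : V => π) ∂π := by
  set e := (MeasurableEquiv.piEquivPiSubtypeProd (fun _ : V => J) (· ∈ N)).symm with he
  obtain ⟨c⟩ : Nonempty ({w // w ∈ N} → J) := inferInstance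
  set F' : ({w // w ∉ N} → J) → J → ℝ≥0∞ := fun z a => F (e (c, z)) a with hF'
  have hF'm : Measurable (Function.uncurry F') := by
    have : Measurable fun p : ({w // w ∉ N} → J) × J => (e (c, p.1), p.2) := by fun_prop
    exact hF.comp this
  have hFe : ∀ y z a, F (e (y, z)) a = F' z a := fun y z a => hFN _ _ _ fun w hw => by
    rw [he, piEquivPiSubtypeProd_symm_of_notMem _ _ hw, piEquivPiSubtypeProd_symm_of_notMem _ _ hw]
  have hprod : ∀ y z, ∏ w ∈ N, g w (e (y, z) w) = ∏ w : {w // w ∈ N}, g w (y w) := fun y z => by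
    rw [← Finset.prod_coe_sort N]
    refine Finset.prod_congr rfl fun w _ => ?_
    rw [he, piEquivPiSubtypeProd_symm_of_mem _ _ w.2]
  have hres : ∀ y z, N.restrict (e (y, z)) = y := fun y z => by
    ext ⟨w, hw⟩
    exact piEquivPiSubtypeProd_symm_of_mem _ _ hw
  have hgm : Measurable fun y : {w // w ∈ N} → J => ∏ w : {w // w ∈ N}, g w (y w) :=
    Finset.measurable_prod _ fun w _ => (hg w).comp (measurable_pi_apply w)
  have hright : ∀ a, ∫⁻ x, F x a ∂(Measure.pi fun _ : V => π) =
      ∫⁻ z, F' z a ∂(Measure.pi fun _ : {w // w ∉ N} => π) := fun a => by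
    rw [lintegral_pi_split π N (by fun_prop)]
    simp_rw [← he, hFe]
    simp
  rw [lintegral_pi_split π N]
  swap
  · refine Measurable.mul (Finset.measurable_prod _ fun w _ => (hg w).comp (measurable_pi_apply w))
      ?_
    exact hF.lintegral_kernel_prod_right'
  simp_rw [← he, hprod, hFe, localKernel_apply, hres, hright]
  calc
    _ = ∫⁻ z, ∫⁻ a, (∏ w ∈ N, ∫⁻ b, g w b ∂(P a)) * F' z a ∂π
          ∂(Measure.pi fun _ : {w // w ∉ N} => π) := by
      refine lintegral_congr fun z => ?_
      have hz : Measurable (F' z) := hF'm.comp measurable_prodMk_left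
      have := lintegral_starKernel h (ι := {w // w ∈ N}) (by simpa using hN)
        (f := fun p => (∏ w : {w // w ∈ N}, g w (p.1 w)) * F' z p.2)
        ((hgm.comp measurable_fst).mul (hz.comp measurable_snd))
      simp only [lintegral_const_mul _ hz, lintegral_mul_const _ hgm] at this
      refine this.trans (lintegral_congr fun a => ?_)
      rw [lintegral_pi_prod (fun _ : {w // w ∈ N} => P a) (g := fun w => g w) (fun w => hg w),
        Finset.prod_coe_sort N fun w => ∫⁻ b, g w b ∂(P a)]
    _ = _ := by
      have hPm : Measurable fun a => ∏ w ∈ N, ∫⁻ b, g w b ∂(P a) :=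
        Finset.measurable_prod _ fun w _ => (hg w).lintegral_kernel
      rw [lintegral_lintegral_swap]
      · refine lintegral_congr fun a => ?_
        rw [lintegral_const_mul]
        exact hF'm.comp measurable_prodMk_right
      · exact ((hPm.comp measurable_snd).mul hF'm).aemeasurable

end localKernel

/-- Two s-finite kernels with the same finite composition-product with a finite measure agree
almost everywhere. -/
lemma kernel_ae_eq_of_compProd_eq {α β : Type*} [MeasurableSpace α] [MeasurableSpace β]
    [MeasurableSpace.CountableOrCountablyGenerated α β] {ρ : Measure α} [IsFiniteMeasure ρ]
    {κ₁ κ₂ : Kernel α β} [IsSFiniteKernel κ₁] [IsSFiniteKernel κ₂]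
    (h : ρ ⊗ₘ κ₁ = ρ ⊗ₘ κ₂) (hfin : (ρ ⊗ₘ κ₁) Set.univ ≠ ∞) : κ₁ =ᵐ[ρ] κ₂ := by
  set m : α → ℝ≥0∞ := fun x => 1 + (κ₁ x Set.univ + κ₂ x Set.univ) with hm
  have hmm : Measurable m := measurable_const.add
    ((κ₁.measurable_coe MeasurableSet.univ).add (κ₂.measurable_coe MeasurableSet.univ))
  have hc : Measurable (Function.uncurry fun (x : α) (_ : β) => (m x)⁻¹) :=
    (hmm.comp measurable_fst).inv
  have happ : ∀ (κ : Kernel α β) [IsSFiniteKernel κ] (x : α),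
      κ.withDensity (fun x _ => (m x)⁻¹) x = (m x)⁻¹ • κ x := fun κ _ x => by
    rw [Kernel.withDensity_apply _ hc, withDensity_const]
  have hle : ∀ {t s : ℝ≥0∞}, t ≤ s → s⁻¹ * t ≤ 1 := fun {t s} hts =>
    (mul_le_mul_right hts _).trans (ENNReal.inv_mul_le_one s)
  have hfin₁ : IsFiniteKernel (κ₁.withDensity fun x _ => (m x)⁻¹) := ⟨1, ENNReal.one_lt_top,
    fun x => by
      rw [happ, Measure.smul_apply, smul_eq_mul]
      exact hle (le_self_add.trans le_add_self)⟩
  have hfin₂ : IsFiniteKernel (κ₂.withDensity fun x _ => (m x)⁻¹) := ⟨1, ENNReal.one_lt_top,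
    fun x => by
      rw [happ, Measure.smul_apply, smul_eq_mul]
      exact hle (le_add_self.trans le_add_self)⟩
  have heq : ρ ⊗ₘ (κ₁.withDensity fun x _ => (m x)⁻¹) =
      ρ ⊗ₘ (κ₂.withDensity fun x _ => (m x)⁻¹) := by
    rw [Measure.compProd_withDensity hc, Measure.compProd_withDensity hc, h]
  have hfin' : ∫⁻ x, m x ∂ρ ≠ ∞ := by
    have h₁ := hfin
    have h₂ := h ▸ hfin
    rw [Measure.compProd_apply MeasurableSet.univ] at h₁ h₂
    simp only [Set.preimage_univ] at h₁ h₂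
    rw [hm, lintegral_add_left measurable_const,
      lintegral_add_left (κ₁.measurable_coe MeasurableSet.univ)]
    simp [h₁, h₂]
  filter_upwards [Kernel.ae_eq_of_compProd_eq heq, ae_lt_top hmm hfin'] with x hx hx'
  rw [happ, happ] at hx
  have h0 : m x ≠ 0 := by simp [hm]
  ext s hs
  have := congr_arg (fun μ : Measure β => m x * μ s) hx
  simpa [← mul_assoc, ENNReal.mul_inv_cancel h0 hx'.ne] using this

/-- Extend a family indexed by `S` by a constant. -/
def extendConst (j₀ : J) (S : Finset V) (z : S → J) : V → J :=
  fun w => if hw : w ∈ S then z ⟨w, hw⟩ else j₀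

omit [MeasurableSpace J] in
lemma extendConst_of_mem (j₀ : J) {S : Finset V} (z : S → J) {w : V} (hw : w ∈ S) :
    extendConst j₀ S z w = z ⟨w, hw⟩ := dif_pos hw

omit [MeasurableSpace J] in
lemma extendConst_restrict_of_mem (j₀ : J) {S : Finset V} (x : V → J) {w : V} (hw : w ∈ S) :
    extendConst j₀ S (S.restrict x) w = x w := extendConst_of_mem j₀ _ hw

omit [MeasurableSpace J] in
lemma restrict_extendConst (j₀ : J) {S : Finset V} (z : S → J) :
    S.restrict (extendConst j₀ S z) = z :=
  funext fun w => extendConst_of_mem j₀ z w.2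

lemma measurable_extendConst (j₀ : J) (S : Finset V) : Measurable (extendConst j₀ S) := by
  refine measurable_pi_lambda _ fun w => ?_
  by_cases hw : w ∈ S
  · simp only [extendConst, hw, dif_pos]; fun_prop
  · simp only [extendConst, hw, dif_neg, not_false_iff]; fun_prop

section twoStep

variable [StandardBorelSpace J] [Nonempty J] (π : Measure J) [IsProbabilityMeasure π]
  (P : Kernel J J) [IsMarkovKernel P]

/-- The law of a pair of points `(a, b)` where `a` is drawn at the vertex `u` given its neighbours
`A`, and then `b` is drawn given its neighbours `insert u B`. -/
noncomputable def twoStep (A B : Finset V) (u : V) : Kernel (V → J) (J × J) :=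
  localKernel π P A ⊗ₖ
    (localKernel π P (insert u B)).comap (fun p => Function.update p.1 u p.2)
      (measurable_update_prod u)

instance (A B : Finset V) (u : V) : IsSFiniteKernel (twoStep π P A B u) := by
  unfold twoStep; infer_instance

lemma lintegral_twoStep (A B : Finset V) (u : V) (x : V → J) {f : J × J → ℝ≥0∞}
    (hf : Measurable f) :
    ∫⁻ p, f p ∂(twoStep π P A B u x) =
      ∫⁻ a, ∫⁻ b, f (a, b) ∂(localKernel π P (insert u B) (Function.update x u a))
        ∂(localKernel π P A x) := by
  rw [twoStep, Kernel.lintegral_compProd _ _ _ hf]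
  rfl

variable {π P}

lemma twoStep_congr {A B : Finset V} {u : V} {x x' : V → J} (h : ∀ w ∈ A ∪ B, x w = x' w) :
    twoStep π P A B u x = twoStep π P A B u x' := by
  refine Measure.ext_of_lintegral _ fun f hf => ?_
  rw [lintegral_twoStep _ _ _ _ _ _ hf, lintegral_twoStep _ _ _ _ _ _ hf,
    localKernel_congr (N := A) fun w hw => h w (mem_union_left _ hw)]
  refine lintegral_congr fun a => ?_
  rw [localKernel_congr (N := insert u B)]
  intro w hw
  by_cases hwu : w = u
  · subst hwu; simp
  · simp only [Function.update_of_ne hwu]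
    exact h w (mem_union_right _ ((mem_insert.1 hw).resolve_left hwu))

lemma lintegral_prod_mul_twoStep [Fintype V] {k : ℕ} (h : KLoose π P k) {A B : Finset V} {u : V}
    (hAB : Disjoint A B) (huA : u ∉ A) (huB : u ∉ B) (hA : A.card ≤ k) (hB : B.card + 1 ≤ k)
    {g : V → J → ℝ≥0∞} (hg : ∀ w, Measurable (g w)) {α β : J → ℝ≥0∞} (hα : Measurable α)
    (hβ : Measurable β) :
    ∫⁻ x, (∏ w ∈ A, g w (x w)) * (∏ w ∈ B, g w (x w)) *
        ∫⁻ p, α p.1 * β p.2 ∂(twoStep π P A B u x) ∂(Measure.pi fun _ : V => π) =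
      ∫⁻ b, ∫⁻ a, (∏ w ∈ A, ∫⁻ c, g w c ∂(P a)) * α a * ((∏ w ∈ B, ∫⁻ c, g w c ∂(P b)) * β b)
        ∂(P b) ∂π := by
  have hgP : ∀ S : Finset V, Measurable fun a => ∏ w ∈ S, ∫⁻ c, g w c ∂(P a) := fun S =>
    Finset.measurable_prod _ fun w _ => (hg w).lintegral_kernel
  have hgS : ∀ S : Finset V, Measurable fun x : V → J => ∏ w ∈ S, g w (x w) := fun S =>
    Finset.measurable_prod _ fun w _ => (hg w).comp (measurable_pi_apply w)
  have hker : Measurable fun p : (V → J) × J =>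
      ∫⁻ b, β b ∂(localKernel π P (insert u B) (Function.update p.1 u p.2)) :=
    (hβ.lintegral_kernel (κ := localKernel π P (insert u B))).comp (measurable_update_prod u)
  set F : (V → J) → J → ℝ≥0∞ := fun x a => (∏ w ∈ B, g w (x w)) *
    (α a * ∫⁻ b, β b ∂(localKernel π P (insert u B) (Function.update x u a))) with hFdef
  have hF : Measurable (Function.uncurry F) :=
    ((hgS B).comp measurable_fst).mul ((hα.comp measurable_snd).mul hker)
  have hFN : ∀ x x' a, (∀ w ∉ A, x w = x' w) → F x a = F x' a := by
    intro x x' a hx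
    simp only [hFdef]
    rw [Finset.prod_congr rfl fun w hw => by
      rw [hx w fun hwA => Finset.disjoint_left.1 hAB hwA hw]]
    rw [localKernel_congr (N := insert u B)]
    intro w hw
    by_cases hwu : w = u
    · subst hwu; simp
    · simp only [Function.update_of_ne hwu]
      exact hx w fun hwA =>
        Finset.disjoint_left.1 hAB hwA ((mem_insert.1 hw).resolve_left hwu)
  set g' : V → J → ℝ≥0∞ :=
    Function.update g u (fun a => (∏ w ∈ A, ∫⁻ c, g w c ∂(P a)) * α a) with hg'
  have hg'm : ∀ w, Measurable (g' w) := by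
    intro w
    by_cases hwu : w = u
    · subst hwu
      simp only [hg', Function.update_self]
      exact (hgP A).mul hα
    · simpa [hg', hwu] using hg w
  have hg'B : ∀ w ∈ B, g' w = g w := fun w hw =>
    Function.update_of_ne (ne_of_mem_of_not_mem hw huB) _ _
  have hcard : (insert u B).card ≤ k := by rwa [card_insert_of_notMem huB]
  set H : (V → J) → ℝ≥0∞ := fun x => (∏ w ∈ insert u B, g' w (x w)) *
    ∫⁻ b, β b ∂(localKernel π P (insert u B) x) with hH
  have hHm : Measurable H := (Finset.measurable_prod _ fun w _ =>
    (hg'm w).comp (measurable_pi_apply w)).mul hβ.lintegral_kernel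
  calc
    _ = ∫⁻ x, (∏ w ∈ A, g w (x w)) * ∫⁻ a, F x a ∂(localKernel π P A x)
          ∂(Measure.pi fun _ : V => π) := by
      refine lintegral_congr fun x => ?_
      rw [lintegral_twoStep _ _ _ _ _ _ (by fun_prop), mul_assoc, ← lintegral_const_mul]
      · simp only [lintegral_const_mul _ hβ, hFdef]
      · exact Measurable.lintegral_kernel_prod_right (κ := (localKernel π P (insert u B)).comap
          (fun a => Function.update x u a) (by fun_prop)) (f := fun a b => α a * β b) (by fun_prop)
    _ = ∫⁻ a, (∏ w ∈ A, ∫⁻ c, g w c ∂(P a)) * ∫⁻ x, F x a ∂(Measure.pi fun _ : V => π) ∂π :=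
      lintegral_localKernel h hA hg hF hFN
    _ = ∫⁻ a, ∫⁻ x, H (Function.update x u a) ∂(Measure.pi fun _ : V => π) ∂π := by
      refine lintegral_congr fun a => ?_
      have hFa : Measurable fun x => F x a := hF.comp measurable_prodMk_right
      rw [← lintegral_const_mul _ hFa]
      refine lintegral_congr fun x => ?_
      simp only [hH, hFdef]
      have hBx : ∏ w ∈ B, g' w (Function.update x u a w) = ∏ w ∈ B, g w (x w) :=
        Finset.prod_congr rfl fun w hw => by
          rw [hg'B w hw, Function.update_of_ne (ne_of_mem_of_not_mem hw huB)]
      rw [prod_insert huB, hBx, Function.update_self, hg', Function.update_self]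
      ring
    _ = ∫⁻ x, H x ∂(Measure.pi fun _ : V => π) := lintegral_update_pi π u hHm
    _ = _ := by
      simp only [hH]
      rw [lintegral_localKernel h hcard hg'm (F := fun _ b => β b) (by fun_prop) (by simp)]
      refine lintegral_congr fun b => ?_
      have hBb : ∏ w ∈ B, ∫⁻ c, g' w c ∂(P b) = ∏ w ∈ B, ∫⁻ c, g w c ∂(P b) :=
        Finset.prod_congr rfl fun w hw => by rw [hg'B w hw]
      have hm : Measurable fun a => (∏ w ∈ A, ∫⁻ c, g w c ∂(P a)) * α a := (hgP A).mul hα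
      rw [prod_insert huB, hBb, hg', Function.update_self, lintegral_mul_const _ hm]
      simp [mul_assoc]

omit [StandardBorelSpace J] [Nonempty J] in
lemma lintegral_lintegral_swap_of_reversible {π : Measure J} [SFinite π] {P : Kernel J J}
    [IsSFiniteKernel P] (hrev : (π ⊗ₘ P).map Prod.swap = π ⊗ₘ P) {f : J → J → ℝ≥0∞}
    (hf : Measurable (Function.uncurry f)) :
    ∫⁻ b, ∫⁻ a, f a b ∂(P b) ∂π = ∫⁻ b, ∫⁻ a, f b a ∂(P b) ∂π := by
  have h₁ := Measure.lintegral_compProd (μ := π) (κ := P) hf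
  have h₂ := Measure.lintegral_compProd (μ := π) (κ := P) (hf.comp measurable_swap)
  rw [← hrev, lintegral_map hf measurable_swap] at h₁
  exact h₂.symm.trans h₁

lemma lintegral_prod_mul_twoStep_swap [Fintype V] {k : ℕ} (h : KLoose π P k)
    (hrev : (π ⊗ₘ P).map Prod.swap = π ⊗ₘ P) {A B : Finset V} {u v : V}
    (hAB : Disjoint A B) (hu : u ∉ A ∪ B) (hv : v ∉ A ∪ B) (hA : A.card + 1 ≤ k)
    (hB : B.card + 1 ≤ k)
    {g : V → J → ℝ≥0∞} (hg : ∀ w, Measurable (g w)) {α β : J → ℝ≥0∞} (hα : Measurable α)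
    (hβ : Measurable β) :
    ∫⁻ x, (∏ w ∈ A ∪ B, g w (x w)) *
        ∫⁻ p, α p.1 * β p.2 ∂(twoStep π P A B u x) ∂(Measure.pi fun _ : V => π) =
      ∫⁻ x, (∏ w ∈ A ∪ B, g w (x w)) *
        ∫⁻ p, α p.1 * β p.2 ∂((twoStep π P B A v).map Prod.swap x)
          ∂(Measure.pi fun _ : V => π) := by
  rw [mem_union, not_or] at hu hv
  have hm : Measurable fun p : J × J => α p.1 * β p.2 := by fun_prop
  simp only [Kernel.lintegral_map _ measurable_swap _ hm, prod_union hAB, Prod.fst_swap,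
    Prod.snd_swap]
  rw [lintegral_prod_mul_twoStep h hAB hu.1 hu.2 (by omega) hB hg hα hβ]
  simp only [mul_comm (∏ w ∈ A, g w _), mul_comm (α _)]
  rw [lintegral_prod_mul_twoStep h hAB.symm hv.2 hv.1 (by omega) hA hg hβ hα]
  have hgP : ∀ S : Finset V, Measurable fun a => ∏ w ∈ S, ∫⁻ c, g w c ∂(P a) := fun S =>
    Finset.measurable_prod _ fun w _ => (hg w).lintegral_kernel
  simp only [mul_comm _ (α _)]
  rw [lintegral_lintegral_swap_of_reversible hrev]
  · simp only [mul_comm]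
  · have := hgP A
    have := hgP B
    fun_prop

lemma kernel_ae_eq_of_lintegral_prod_mul [Fintype V] {κ₁ κ₂ : Kernel (V → J) (J × J)}
    [IsSFiniteKernel κ₁] [IsSFiniteKernel κ₂] {C : Finset V}
    (h₁ : ∀ x x', (∀ w ∈ C, x w = x' w) → κ₁ x = κ₁ x')
    (h₂ : ∀ x x', (∀ w ∈ C, x w = x' w) → κ₂ x = κ₂ x')
    (heq : ∀ (g : V → J → ℝ≥0∞) (α β : J → ℝ≥0∞), (∀ w, Measurable (g w)) → Measurable α →
      Measurable β →
      ∫⁻ x, (∏ w ∈ C, g w (x w)) * ∫⁻ p, α p.1 * β p.2 ∂(κ₁ x) ∂(Measure.pi fun _ : V => π) =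
      ∫⁻ x, (∏ w ∈ C, g w (x w)) * ∫⁻ p, α p.1 * β p.2 ∂(κ₂ x) ∂(Measure.pi fun _ : V => π))
    (hfin : ∫⁻ x, κ₁ x Set.univ ∂(Measure.pi fun _ : V => π) ≠ ∞) {ρ : Measure (V → J)}
    (hρ : ρ.map C.restrict ≪ (Measure.pi fun _ : V => π).map C.restrict) :
    ∀ᵐ x ∂ρ, κ₁ x = κ₂ x := by
  obtain ⟨j₀⟩ : Nonempty J := inferInstance
  set e : (C → J) → V → J := extendConst j₀ C
  have hem : Measurable e := measurable_extendConst j₀ C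
  have her : ∀ x, ∀ w ∈ C, e (C.restrict x) w = x w := fun x w hw =>
    extendConst_restrict_of_mem j₀ x hw
  have hr := Finset.measurable_restrict (X := fun _ : V => J) C
  have key : ∀ (κ : Kernel (V → J) (J × J)) [IsSFiniteKernel κ],
      (∀ x x', (∀ w ∈ C, x w = x' w) → κ x = κ x') →
      ∀ (E : C → Set J) (s t : Set J), (∀ i, MeasurableSet (E i)) → MeasurableSet s →
        MeasurableSet t →
      ((Measure.pi fun _ : V => π).map C.restrict ⊗ₘ κ.comap e hem)
        ((Set.univ.pi E) ×ˢ s ×ˢ t) =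
      ∫⁻ x, (∏ w ∈ C, (if hw : w ∈ C then (E ⟨w, hw⟩).indicator 1 else 1 : J → ℝ≥0∞) (x w)) *
        ∫⁻ p, s.indicator 1 p.1 * t.indicator 1 p.2 ∂(κ x) ∂(Measure.pi fun _ : V => π) := by
    intro κ _ hκ E s t hE hs ht
    have hst : ∀ p : J × J, (s ×ˢ t).indicator (1 : J × J → ℝ≥0∞) p =
        s.indicator 1 p.1 * t.indicator 1 p.2 := fun p => by
      by_cases h1 : p.1 ∈ s <;> by_cases h2 : p.2 ∈ t <;> simp [Set.indicator, h1, h2]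
    rw [Measure.compProd_apply_prod (MeasurableSet.univ_pi hE) (hs.prod ht),
      ← lintegral_indicator (MeasurableSet.univ_pi hE), lintegral_map _ hr]
    swap
    · exact ((κ.comap e hem).measurable_coe (hs.prod ht)).indicator (MeasurableSet.univ_pi hE)
    refine lintegral_congr fun x => ?_
    simp only [← hst]
    rw [lintegral_indicator_one (hs.prod ht), ← hκ _ _ (her x), ← Finset.prod_coe_sort]
    have hE' : ∀ w : C, (if hw : (w : V) ∈ C then (E ⟨w, hw⟩).indicator 1 else 1 : J → ℝ≥0∞) (x w) =
        (E w).indicator 1 (C.restrict x w) := fun w => by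
      rw [dif_pos w.2]
      rfl
    simp only [hE']
    by_cases hx : C.restrict x ∈ Set.univ.pi E
    · rw [Set.indicator_of_mem hx, Finset.prod_eq_one, one_mul]
      · rfl
      · intro w _
        exact Set.indicator_of_mem (hx w (Set.mem_univ w)) _
    · rw [Set.indicator_of_notMem hx]
      simp only [Set.mem_pi, Set.mem_univ, true_imp_iff, not_forall] at hx
      obtain ⟨w, hw⟩ := hx
      rw [Finset.prod_eq_zero (Finset.mem_univ w), zero_mul]
      exact Set.indicator_of_notMem hw _
  have hfin' : ((Measure.pi fun _ : V => π).map C.restrict ⊗ₘ κ₁.comap e hem) Set.univ ≠ ∞ := by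
    rw [Measure.compProd_apply MeasurableSet.univ, lintegral_map _ hr]
    · simp only [Set.preimage_univ, Kernel.comap_apply]
      simpa only [h₁ _ _ (her _)] using hfin
    · exact (κ₁.comap e hem).measurable_coe MeasurableSet.univ
  have hcomp : (Measure.pi fun _ : V => π).map C.restrict ⊗ₘ κ₁.comap e hem =
      (Measure.pi fun _ : V => π).map C.restrict ⊗ₘ κ₂.comap e hem := by
    have hrect : ∀ (E : C → Set J) (s t : Set J), (∀ i, MeasurableSet (E i)) → MeasurableSet s →
        MeasurableSet t →
        ((Measure.pi fun _ : V => π).map C.restrict ⊗ₘ κ₁.comap e hem)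
          ((Set.univ.pi E) ×ˢ s ×ˢ t) =
        ((Measure.pi fun _ : V => π).map C.restrict ⊗ₘ κ₂.comap e hem)
          ((Set.univ.pi E) ×ˢ s ×ˢ t) := by
      intro E s t hE hs ht
      rw [key κ₁ h₁ E s t hE hs ht, key κ₂ h₂ E s t hE hs ht]
      refine heq _ _ _ (fun w => ?_) (measurable_one.indicator hs) (measurable_one.indicator ht)
      by_cases hw : w ∈ C
      · simp only [hw, dif_pos]
        exact measurable_one.indicator (hE _)
      · simp only [hw, dif_neg, not_false_iff]
        exact measurable_one
    have : IsFiniteMeasure ((Measure.pi fun _ : V => π).map C.restrict ⊗ₘ κ₁.comap e hem) :=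
      ⟨hfin'.lt_top⟩
    refine ext_of_generate_finite
      (Set.image2 (· ×ˢ ·) (Set.univ.pi '' Set.univ.pi fun _ : C => {s : Set J | MeasurableSet s})
        (Set.image2 (· ×ˢ ·) {s : Set J | MeasurableSet s} {s : Set J | MeasurableSet s}))
      ?_ (isPiSystem_pi.prod isPiSystem_prod) ?_ ?_
    · refine (generateFrom_eq_prod generateFrom_pi generateFrom_prod ?_ ?_).symm
      · exact ⟨fun _ => Set.univ, fun _ => ⟨fun _ => Set.univ, by simp, by simp⟩,
          Set.iUnion_const _⟩
      · exact isCountablySpanning_measurableSet.prod isCountablySpanning_measurableSet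
    · rintro _ ⟨_, ⟨E, hE, rfl⟩, _, ⟨s, hs, t, ht, rfl⟩, rfl⟩
      exact hrect E s t (fun i => hE i (Set.mem_univ i)) hs ht
    · simpa using hrect (fun _ => Set.univ) Set.univ Set.univ (by simp) MeasurableSet.univ
        MeasurableSet.univ
  have hae := ae_of_ae_map hr.aemeasurable (hρ.ae_le (kernel_ae_eq_of_compProd_eq hcomp hfin'))
  filter_upwards [hae] with x hx
  rw [← h₁ _ _ (her x), ← h₂ _ _ (her x)]
  exact hx

/-- Given the neighbours of two adjacent vertices, it does not matter which of the two is drawn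
first. -/
lemma twoStep_ae_eq_map_swap [Fintype V] {k : ℕ} (h : KLoose π P k)
    (hrev : (π ⊗ₘ P).map Prod.swap = π ⊗ₘ P) {A B : Finset V} {u v : V}
    (hAB : Disjoint A B) (hu : u ∉ A ∪ B) (hv : v ∉ A ∪ B) (hA : A.card + 1 ≤ k)
    (hB : B.card + 1 ≤ k) {ρ : Measure (V → J)}
    (hρ : ρ.map (A ∪ B).restrict ≪ (Measure.pi fun _ : V => π).map (A ∪ B).restrict) :
    ∀ᵐ x ∂ρ, twoStep π P A B u x = (twoStep π P B A v).map Prod.swap x := by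
  refine kernel_ae_eq_of_lintegral_prod_mul (π := π) (fun x x' => twoStep_congr)
    (fun x x' hx => ?_)
    (fun g α β hg hα hβ => lintegral_prod_mul_twoStep_swap h hrev hAB hu hv hA hB hg hα hβ)
    ?_ hρ
  · rw [Kernel.map_apply _ measurable_swap, Kernel.map_apply _ measurable_swap,
      twoStep_congr (x' := x') (by rwa [union_comm])]
  · rw [mem_union, not_or] at hu
    have := lintegral_prod_mul_twoStep h hAB hu.1 hu.2 (by omega) hB (g := fun _ _ => 1)
      (fun _ => measurable_one) (α := 1) (β := 1) measurable_one measurable_one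
    simp at this
    simp [this]

end twoStep

/-- The neighbours of `v` in the finset `S`. -/
def nbrs (G : SimpleGraph V) [DecidableRel G.Adj] (v : V) (S : Finset V) : Finset V :=
  S.filter (G.Adj v)

section nbrs

variable {G : SimpleGraph V} [DecidableRel G.Adj]

omit [DecidableEq V] in
lemma mem_nbrs {v w : V} {S : Finset V} : w ∈ nbrs G v S ↔ w ∈ S ∧ G.Adj v w := mem_filter

lemma nbrs_insert_of_adj {u v : V} {S : Finset V} (h : G.Adj v u) :
    nbrs G v (insert u S) = insert u (nbrs G v S) := by
  rw [nbrs, filter_insert, if_pos h, nbrs]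

lemma nbrs_insert_of_not_adj {u v : V} {S : Finset V} (h : ¬ G.Adj v u) :
    nbrs G v (insert u S) = nbrs G v S := by
  rw [nbrs, filter_insert, if_neg h, nbrs]

end nbrs

/-- The configuration which agrees with `z` on the members of `l` and with `x` elsewhere. -/
def overwrite (l : List V) (x z : V → J) : V → J := fun w => if w ∈ l then z w else x w

omit [MeasurableSpace J] in
lemma overwrite_of_mem {l : List V} {w : V} (h : w ∈ l) (x z : V → J) :
    overwrite l x z w = z w := if_pos h

omit [MeasurableSpace J] in
lemma overwrite_of_notMem {l : List V} {w : V} (h : w ∉ l) (x z : V → J) :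
    overwrite l x z w = x w := if_neg h

omit [MeasurableSpace J] in
lemma update_overwrite (l : List V) (x z : V → J) (u : V) (a : J) :
    Function.update (overwrite l x z) u a = overwrite (u :: l) x (Function.update z u a) := by
  ext w
  by_cases hw : w = u
  · subst hw
    simp [overwrite]
  · simp [overwrite, hw]

lemma measurable_update_update (x : V → J) (u v : V) :
    Measurable fun p : J × J => Function.update (Function.update x v p.1) u p.2 :=
  (measurable_update_prod u).comp
    ((((measurable_update_prod v).comp measurable_prodMk_left).comp measurable_fst).prodMk
      measurable_snd)

section walk

variable [StandardBorelSpace J] [Nonempty J] (π : Measure J) [IsProbabilityMeasure π]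
  (P : Kernel J J) [IsMarkovKernel P] (G : SimpleGraph V) [DecidableRel G.Adj]

/-- Redraw the value at `v` given the values at the neighbours of `v` in `S`. -/
noncomputable def step (S : Finset V) (v : V) : Kernel (V → J) (V → J) :=
  (Kernel.id ×ₖ localKernel π P (nbrs G v S)).map fun p => Function.update p.1 v p.2

instance (S : Finset V) (v : V) : IsSFiniteKernel (step π P G S v) := by
  unfold step; infer_instance

lemma lintegral_step (S : Finset V) (v : V) (x : V → J) {f : (V → J) → ℝ≥0∞}
    (hf : Measurable f) :
    ∫⁻ y, f y ∂(step π P G S v x) =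
      ∫⁻ a, f (Function.update x v a) ∂(localKernel π P (nbrs G v S) x) := by
  rw [step, Kernel.lintegral_map _ (measurable_update_prod v) _ hf,
    Kernel.lintegral_id_prod (f := fun p => f (Function.update p.1 v p.2))
      (hf.comp (measurable_update_prod v))]

/-- Starting from the values on `S`, draw the values at the vertices in the list `l` one after
another, from the end of the list to its beginning, each given its neighbours drawn before. -/
noncomputable def walk (S : Finset V) : List V → Kernel (V → J) (V → J)
  | [] => Kernel.id
  | u :: l => step π P G (S ∪ l.toFinset) u ∘ₖ walk S l

lemma walk_nil (S : Finset V) : walk π P G S [] = Kernel.id := rfl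

lemma walk_cons (S : Finset V) (u : V) (l : List V) :
    walk π P G S (u :: l) = step π P G (S ∪ l.toFinset) u ∘ₖ walk π P G S l := rfl

instance (S : Finset V) (l : List V) : IsSFiniteKernel (walk π P G S l) := by
  induction l with
  | nil => rw [walk_nil]; infer_instance
  | cons u l ih => rw [walk_cons]; infer_instance

lemma walk_append (S : Finset V) (l₁ l₂ : List V) :
    walk π P G S (l₁ ++ l₂) = walk π P G (S ∪ l₂.toFinset) l₁ ∘ₖ walk π P G S l₂ := by
  induction l₁ with
  | nil => rw [List.nil_append, walk_nil, Kernel.id_comp]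
  | cons u l ih =>
    rw [List.cons_append, walk_cons, walk_cons, ih, Kernel.comp_assoc, List.toFinset_append,
      union_comm l.toFinset, union_assoc]

lemma measurable_lintegral_update (S : Finset V) (v : V) {f : (V → J) → ℝ≥0∞}
    (hf : Measurable f) :
    Measurable fun x => ∫⁻ a, f (Function.update x v a) ∂(localKernel π P S x) :=
  Measurable.lintegral_kernel_prod_right' (κ := localKernel π P S)
    (hf.comp (measurable_update_prod v))

lemma lintegral_walk_cons (S : Finset V) (u : V) (l : List V) (x : V → J) {f : (V → J) → ℝ≥0∞}
    (hf : Measurable f) :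
    ∫⁻ y, f y ∂(walk π P G S (u :: l) x) =
      ∫⁻ y, ∫⁻ a, f (Function.update y u a) ∂(localKernel π P (nbrs G u (S ∪ l.toFinset)) y)
        ∂(walk π P G S l x) := by
  rw [walk_cons, Kernel.lintegral_comp _ _ _ hf]
  simp only [lintegral_step _ _ _ _ _ _ hf]

variable {π P G}

lemma lintegral_walk_congr {S : Finset V} {l : List V} {x x' : V → J} {f f' : (V → J) → ℝ≥0∞}
    (hf : Measurable f) (hf' : Measurable f') (hx : ∀ w ∈ S, x w = x' w)
    (hff' : ∀ z, f (overwrite l x z) = f' (overwrite l x' z)) :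
    ∫⁻ y, f y ∂(walk π P G S l x) = ∫⁻ y, f' y ∂(walk π P G S l x') := by
  induction l generalizing f f' with
  | nil =>
    simp only [walk_nil, Kernel.id_apply, lintegral_dirac' _ hf, lintegral_dirac' _ hf']
    exact hff' x
  | cons u l ih =>
    rw [lintegral_walk_cons _ _ _ _ _ _ _ hf, lintegral_walk_cons _ _ _ _ _ _ _ hf']
    refine ih (measurable_lintegral_update _ _ _ _ hf) (measurable_lintegral_update _ _ _ _ hf')
      fun z => ?_
    have : localKernel π P (nbrs G u (S ∪ l.toFinset)) (overwrite l x z) =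
        localKernel π P (nbrs G u (S ∪ l.toFinset)) (overwrite l x' z) :=
      localKernel_congr fun w hw => by
        by_cases hwl : w ∈ l
        · rw [overwrite_of_mem hwl, overwrite_of_mem hwl]
        · rw [overwrite_of_notMem hwl, overwrite_of_notMem hwl]
          have := (mem_nbrs.1 hw).1
          rw [mem_union, List.mem_toFinset] at this
          exact hx w (this.resolve_right hwl)
    rw [this]
    refine lintegral_congr fun a => ?_
    rw [update_overwrite, update_overwrite]
    exact hff' _

lemma walk_apply_eq_zero {S : Finset V} {l : List V} {x : V → J} {s : Set (V → J)}
    (hs : MeasurableSet s) (h : ∀ z, overwrite l x z ∉ s) : walk π P G S l x s = 0 := by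
  rw [← lintegral_indicator_one hs, lintegral_walk_congr (f' := fun _ => 0)
    (measurable_one.indicator hs) measurable_const (fun _ _ => rfl)
    (fun z => Set.indicator_of_notMem (h z) _), lintegral_zero]

variable [Fintype V]

variable (π P G) in
/-- The joint law of the values drawn along the list `l`; the values at vertices outside of `l` are
independent with law `π`. -/
noncomputable def listMeasure (l : List V) : Measure (V → J) :=
  walk π P G ∅ l ∘ₘ Measure.pi fun _ : V => π

instance (l : List V) : SFinite (listMeasure π P G l) := by
  unfold listMeasure; infer_instance

lemma listMeasure_nil : listMeasure π P G [] = Measure.pi fun _ : V => π := by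
  rw [listMeasure, walk_nil, Measure.id_comp]

lemma listMeasure_append (l₁ l₂ : List V) :
    listMeasure π P G (l₁ ++ l₂) = walk π P G l₂.toFinset l₁ ∘ₘ listMeasure π P G l₂ := by
  rw [listMeasure, walk_append, empty_union, listMeasure, Measure.comp_assoc]

lemma listMeasure_cons (u : V) (l : List V) :
    listMeasure π P G (u :: l) = step π P G l.toFinset u ∘ₘ listMeasure π P G l := by
  rw [listMeasure, walk_cons, empty_union, listMeasure, Measure.comp_assoc]

lemma map_restrict_listMeasure_append {l₁ l₂ : List V} {S : Finset V} (hS : ∀ w ∈ l₁, w ∉ S) :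
    (listMeasure π P G (l₁ ++ l₂)).map S.restrict ≪ (listMeasure π P G l₂).map S.restrict := by
  have hr := Finset.measurable_restrict (X := fun _ : V => J) S
  refine Measure.AbsolutelyContinuous.mk fun s hs h0 => ?_
  rw [Measure.map_apply hr hs] at h0 ⊢
  rw [listMeasure_append, Measure.bind_apply (hr hs) (Kernel.aemeasurable _),
    lintegral_eq_zero_iff (Kernel.measurable_coe _ (hr hs))]
  filter_upwards [measure_eq_zero_iff_ae_notMem.1 h0] with x hx
  refine walk_apply_eq_zero (hr hs) fun z hz => hx ?_
  have : S.restrict (overwrite l₁ x z) = S.restrict x := by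
    ext ⟨w, hw⟩
    exact overwrite_of_notMem (fun h => hS w h hw) _ _
  rwa [Set.mem_preimage, this] at hz

lemma step_comp_pi_of_nbrs_eq_empty {k : ℕ} (h : KLoose π P k) {S : Finset V} {v : V}
    (hS : nbrs G v S = ∅) :
    (step π P G S v ∘ₘ Measure.pi fun _ : V => π) = Measure.pi fun _ : V => π := by
  refine Measure.ext_of_lintegral _ fun f hf => ?_
  rw [Measure.lintegral_bind (Kernel.aemeasurable _) hf.aemeasurable]
  simp only [lintegral_step _ _ _ _ _ _ hf, hS]
  have := lintegral_localKernel h (N := ∅) (by simp) (g := fun _ _ => 1)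
    (fun _ => measurable_one) (F := fun x a => f (Function.update x v a))
    (hf.comp (measurable_update_prod v)) (fun x x' a hx => by rw [funext fun w => hx w (by simp)])
  simp only [prod_empty, one_mul] at this
  rw [this, lintegral_update_pi π v hf]

lemma listMeasure_of_independent {k : ℕ} (h : KLoose π P k) {l : List V}
    (hl : ∀ u ∈ l, ∀ v ∈ l, ¬ G.Adj u v) :
    listMeasure π P G l = Measure.pi fun _ : V => π := by
  induction l with
  | nil => exact listMeasure_nil
  | cons u l ih =>
    rw [listMeasure_cons, ih fun v hv w hw => hl v (.tail _ hv) w (.tail _ hw)]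
    refine step_comp_pi_of_nbrs_eq_empty h (Finset.eq_empty_of_forall_notMem fun w hw => ?_)
    rw [mem_nbrs, List.mem_toFinset] at hw
    exact hl u (.head _) w (.tail _ hw.1) hw.2

variable (π P G) in
/-- The hypotheses on the Markov kernel and on the graph under which the values at the vertices can
be drawn in any order. -/
structure SequentiallyLoose (k : ℕ) : Prop where
  loose : KLoose π P k
  reversible : (π ⊗ₘ P).map Prod.swap = π ⊗ₘ P
  card_nbrs_le : ∀ v S, (nbrs G v S).card ≤ k
  triangleFree : ∀ u v w, G.Adj u v → G.Adj v w → ¬ G.Adj w u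
  fourCycleFree : ∀ a b c d : V, G.Adj a b → G.Adj b c → G.Adj c d → G.Adj d a → a = c ∨ b = d

omit [Fintype V] in
lemma step_comp_step_apply_of_not_adj {S : Finset V} {u v : V} (huv : u ≠ v) (hu : u ∉ S)
    (hv : v ∉ S) (hadj : ¬ G.Adj u v) :
    step π P G (insert v S) u ∘ₖ step π P G S v =
      step π P G (insert u S) v ∘ₖ step π P G S u := by
  refine Kernel.ext_fun fun x f hf => ?_
  rw [Kernel.lintegral_comp _ _ _ hf, Kernel.lintegral_comp _ _ _ hf]
  simp only [lintegral_step _ _ _ _ _ _ hf]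
  rw [lintegral_step _ _ _ _ _ _ (measurable_lintegral_update _ _ _ _ hf),
    lintegral_step _ _ _ _ _ _ (measurable_lintegral_update _ _ _ _ hf),
    nbrs_insert_of_not_adj hadj, nbrs_insert_of_not_adj fun h => hadj h.symm]
  have key : ∀ {w w' : V} (a : J), w' ∉ S →
      localKernel π P (nbrs G w S) (Function.update x w' a) = localKernel π P (nbrs G w S) x :=
    fun {w w'} a hw' => localKernel_congr fun t ht =>
      Function.update_of_ne (ne_of_mem_of_not_mem (mem_nbrs.1 ht).1 hw') _ _
  simp only [key _ hu, key _ hv]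
  rw [lintegral_lintegral_swap]
  · simp only [Function.update_comm huv]
  · exact (hf.comp (measurable_update_update x u v)).aemeasurable

omit [Fintype V] in
lemma step_comp_step_apply_of_adj {S : Finset V} {u v : V} (hadj : G.Adj u v) (x : V → J)
    {f : (V → J) → ℝ≥0∞} (hf : Measurable f) :
    ∫⁻ y, f y ∂((step π P G (insert v S) u ∘ₖ step π P G S v) x) =
      ∫⁻ p, f (Function.update (Function.update x v p.1) u p.2)
        ∂(twoStep π P (nbrs G v S) (nbrs G u S) v x) := by
  rw [Kernel.lintegral_comp _ _ _ hf, lintegral_twoStep _ _ _ _ _ _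
    (f := fun p => f (Function.update (Function.update x v p.1) u p.2))
    (hf.comp (measurable_update_update x u v))]
  simp only [lintegral_step _ _ _ _ _ _ hf]
  rw [lintegral_step _ _ _ _ _ _ (measurable_lintegral_update _ _ _ _ hf),
    nbrs_insert_of_adj hadj]

lemma SequentiallyLoose.step_comp_step_ae_eq {k : ℕ} (h : SequentiallyLoose π P G k)
    {S : Finset V} {u v : V} (huv : u ≠ v) (hu : u ∉ S) (hv : v ∉ S) {ρ : Measure (V → J)}
    (hρ : ∀ C ⊆ S, (∀ w ∈ C, ∀ w' ∈ C, ¬ G.Adj w w') →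
      ρ.map C.restrict ≪ (Measure.pi fun _ : V => π).map C.restrict) :
    ∀ᵐ x ∂ρ, (step π P G (insert v S) u ∘ₖ step π P G S v) x =
      (step π P G (insert u S) v ∘ₖ step π P G S u) x := by
  by_cases hadj : G.Adj u v
  swap
  · rw [step_comp_step_apply_of_not_adj huv hu hv hadj]
    simp
  have hsub : nbrs G v S ∪ nbrs G u S ⊆ S :=
    union_subset (filter_subset _ _) (filter_subset _ _)
  have hcard : ∀ {w w'}, G.Adj w w' → w' ∉ S → (nbrs G w S).card + 1 ≤ k :=
    fun {w w'} hww' hw' => by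
      rw [← card_insert_of_notMem (fun hm => hw' (mem_nbrs.1 hm).1), ← nbrs_insert_of_adj hww']
      exact h.card_nbrs_le _ _
  have hae := twoStep_ae_eq_map_swap h.loose h.reversible (A := nbrs G v S) (B := nbrs G u S)
    (u := v) (v := u)
    (Finset.disjoint_left.2 fun w hw hw' =>
      h.triangleFree u v w hadj (mem_nbrs.1 hw).2 (mem_nbrs.1 hw').2.symm)
    (fun hm => hv (hsub hm)) (fun hm => hu (hsub hm)) (hcard hadj.symm hu) (hcard hadj hv)
    (hρ _ hsub ?_)
  · filter_upwards [hae] with x hx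
    refine Measure.ext_of_lintegral _ fun f hf => ?_
    rw [step_comp_step_apply_of_adj hadj _ hf, step_comp_step_apply_of_adj hadj.symm _ hf, hx,
      Kernel.lintegral_map (f := Prod.swap)
        (g' := fun p => f (Function.update (Function.update x v p.1) u p.2)) _ measurable_swap _
        (hf.comp (measurable_update_update x u v))]
    simp only [Prod.fst_swap, Prod.snd_swap, Function.update_comm huv]
  · intro w hw w' hw' hww'
    have hne : ∀ {a b}, a ∈ nbrs G v S ∪ nbrs G u S → b ∉ S → a ≠ b := fun ha hb =>
      ne_of_mem_of_not_mem (hsub ha) hb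
    rcases mem_union.1 hw with h1 | h1 <;> rcases mem_union.1 hw' with h2 | h2
    · exact h.triangleFree _ _ _ (mem_nbrs.1 h1).2 hww' (mem_nbrs.1 h2).2.symm
    · exact (h.fourCycleFree v w w' u (mem_nbrs.1 h1).2 hww' (mem_nbrs.1 h2).2.symm hadj).elim
        (fun e => hne hw' hv e.symm) (fun e => hne hw hu e)
    · exact (h.fourCycleFree u w w' v (mem_nbrs.1 h1).2 hww' (mem_nbrs.1 h2).2.symm
        hadj.symm).elim (fun e => hne hw' hu e.symm) (fun e => hne hw hv e)
    · exact h.triangleFree _ _ _ (mem_nbrs.1 h1).2 hww' (mem_nbrs.1 h2).2.symm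

lemma SequentiallyLoose.map_restrict_listMeasure {k : ℕ} (h : SequentiallyLoose π P G k)
    {l : List V} (hperm : ∀ l' : List V, l.Perm l' → listMeasure π P G l = listMeasure π P G l')
    {C : Finset V} (hC : ∀ w ∈ C, ∀ w' ∈ C, ¬ G.Adj w w') :
    (listMeasure π P G l).map C.restrict ≪ (Measure.pi fun _ : V => π).map C.restrict := by
  rw [hperm (l.filter (· ∉ C) ++ l.filter (· ∈ C)) ?_,
    ← listMeasure_of_independent (G := G) h.loose (l := l.filter (· ∈ C))]
  · exact map_restrict_listMeasure_append (by simp)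
  · intro w hw w' hw'
    exact hC w (by simpa using (List.mem_filter.1 hw).2) w'
      (by simpa using (List.mem_filter.1 hw').2)
  · have := (List.filter_append_perm (fun w => decide (w ∉ C)) l).symm
    simpa using this

/-- The law of the values drawn along a list does not depend on the order of the list. -/
lemma SequentiallyLoose.listMeasure_perm {k : ℕ} (h : SequentiallyLoose π P G k)
    {l l' : List V} (hl : l.Nodup) (hll' : l.Perm l') :
    listMeasure π P G l = listMeasure π P G l' := by
  obtain ⟨n, hn⟩ : ∃ n, l.length ≤ n := ⟨_, le_rfl⟩
  induction n generalizing l l' with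
  | zero =>
    obtain rfl : l = [] := by simpa using hn
    rw [hll'.nil_eq]
  | succ n ih =>
    induction hll' with
    | nil => rfl
    | @cons u l₁ l₂ h₁₂ ih₁₂ =>
      rw [listMeasure_cons, listMeasure_cons, ih₁₂ (List.nodup_cons.1 hl).2
        (by simp only [List.length_cons] at hn; omega), List.toFinset_eq_of_perm _ _ h₁₂]
    | swap u v l =>
      simp only [List.nodup_cons, List.mem_cons, not_or, List.length_cons] at hl hn
      rw [listMeasure_cons, listMeasure_cons, listMeasure_cons, listMeasure_cons,
        Measure.comp_assoc, Measure.comp_assoc, List.toFinset_cons, List.toFinset_cons]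
      exact Measure.bind_congr_right (h.step_comp_step_ae_eq hl.1.1 (by simpa using hl.1.2)
        (by simpa using hl.2.1) fun C _ hC => h.map_restrict_listMeasure
          (fun l' hl' => ih hl.2.2 hl' (by omega)) hC)
    | trans h₁₂ h₂₃ ih₁₂ ih₂₃ =>
      rw [ih₁₂ hl hn, ih₂₃ (h₁₂.nodup_iff.1 hl) (h₁₂.length_eq ▸ hn)]

omit [StandardBorelSpace J] [Fintype V] in
lemma ae_eq_zero_of_map_restrict_absolutelyContinuous {S : Finset V} {q : (V → J) → ℝ≥0∞}
    (hq : Measurable q) (hqS : ∀ x x', (∀ w ∈ S, x w = x' w) → q x = q x')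
    {ρ ρ' : Measure (V → J)} (hρ : ρ.map S.restrict ≪ ρ'.map S.restrict)
    (h0 : q =ᵐ[ρ'] 0) : q =ᵐ[ρ] 0 := by
  obtain ⟨j₀⟩ : Nonempty J := inferInstance
  have hr := Finset.measurable_restrict (X := fun _ : V => J) S
  have hem := measurable_extendConst (V := V) j₀ S
  have hqe : ∀ x, q (extendConst j₀ S (S.restrict x)) = q x := fun x =>
    hqS _ _ fun w hw => extendConst_restrict_of_mem j₀ x hw
  have hset : MeasurableSet {z : S → J | q (extendConst j₀ S z) = 0} :=
    (hq.comp hem) (measurableSet_singleton 0)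
  have h1 : ∀ᵐ z ∂(ρ'.map S.restrict), q (extendConst j₀ S z) = 0 := by
    rw [ae_map_iff hr.aemeasurable hset]
    filter_upwards [h0] with x hx
    rw [hqe]
    exact hx
  filter_upwards [ae_of_ae_map hr.aemeasurable (hρ.ae_le h1)] with x hx
  rw [← hqe]
  exact hx

lemma map_restrict_walk_absolutelyContinuous {lS l : List V} {ρ : Measure (V → J)}
    (hρ : ρ.map lS.toFinset.restrict ≪ (listMeasure π P G lS).map lS.toFinset.restrict)
    {C : Finset V} (hC : C ⊆ lS.toFinset ∪ l.toFinset) :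
    (walk π P G lS.toFinset l ∘ₘ ρ).map C.restrict ≪
      (listMeasure π P G (l ++ lS)).map C.restrict := by
  have hr := Finset.measurable_restrict (X := fun _ : V => J) C
  refine Measure.AbsolutelyContinuous.mk fun s hs h0 => ?_
  rw [listMeasure_append] at h0
  rw [Measure.map_apply hr hs, Measure.bind_apply (hr hs) (Kernel.aemeasurable _),
    lintegral_eq_zero_iff (Kernel.measurable_coe _ (hr hs))] at h0 ⊢
  refine ae_eq_zero_of_map_restrict_absolutelyContinuous (Kernel.measurable_coe _ (hr hs))
    (fun x x' hx => ?_) hρ h0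
  rw [← lintegral_indicator_one (hr hs), ← lintegral_indicator_one (hr hs)]
  refine lintegral_walk_congr (measurable_one.indicator (hr hs))
    (measurable_one.indicator (hr hs)) hx fun z => ?_
  have : C.restrict (overwrite l x z) = C.restrict (overwrite l x' z) := by
    ext ⟨w, hw⟩
    by_cases hwl : w ∈ l
    · simp [overwrite_of_mem hwl]
    · have := hC hw
      rw [mem_union, List.mem_toFinset (l := l)] at this
      simp [overwrite_of_notMem hwl, hx w (this.resolve_right hwl)]
  have hmem : overwrite l x z ∈ C.restrict ⁻¹' s ↔ overwrite l x' z ∈ C.restrict ⁻¹' s := by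
    rw [Set.mem_preimage, Set.mem_preimage, this]
  by_cases hmem' : overwrite l x z ∈ C.restrict ⁻¹' s
  · rw [Set.indicator_of_mem hmem', Set.indicator_of_mem (hmem.1 hmem'), Pi.one_apply, Pi.one_apply]
  · rw [Set.indicator_of_notMem hmem', Set.indicator_of_notMem (fun h' => hmem' (hmem.2 h'))]

lemma SequentiallyLoose.walk_perm {k : ℕ} (h : SequentiallyLoose π P G k) {l l' lS : List V}
    (hl : (l ++ lS).Nodup) (hll' : l.Perm l') {ρ : Measure (V → J)}
    (hρ : ρ.map lS.toFinset.restrict ≪ (listMeasure π P G lS).map lS.toFinset.restrict) :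
    ∀ᵐ x ∂ρ, walk π P G lS.toFinset l x = walk π P G lS.toFinset l' x := by
  induction hll' with
  | nil => simp
  | @cons u l₁ l₂ h₁₂ ih =>
    filter_upwards [ih (List.nodup_cons.1 hl).2] with x hx
    rw [walk_cons, walk_cons, Kernel.comp_apply, Kernel.comp_apply, hx,
      List.toFinset_eq_of_perm _ _ h₁₂]
  | swap u v l =>
    simp only [List.cons_append, List.nodup_cons, List.mem_cons, not_or] at hl
    have hmem : ∀ {w}, w ∉ l ++ lS → w ∉ lS.toFinset ∪ l.toFinset := fun {w} hw hw' =>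
      hw (by simpa [or_comm] using hw')
    have hae := h.step_comp_step_ae_eq hl.1.1 (hmem hl.1.2) (hmem hl.2.1)
      (ρ := walk π P G lS.toFinset l ∘ₘ ρ) fun C hCS hC =>
        (map_restrict_walk_absolutelyContinuous hρ hCS).trans
          (h.map_restrict_listMeasure (fun l' hl' => h.listMeasure_perm hl.2.2 hl') hC)
    filter_upwards [Measure.ae_ae_of_ae_comp hae] with x hx
    simp only [walk_cons, ← Kernel.comp_assoc, List.toFinset_cons, union_insert]
    rw [Kernel.comp_apply, Kernel.comp_apply _ (walk π P G lS.toFinset l)]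
    exact Measure.bind_congr_right hx
  | trans h₁₂ h₂₃ ih₁₂ ih₂₃ =>
    filter_upwards [ih₁₂ hl, ih₂₃ ((h₁₂.append_right _).nodup_iff.1 hl)] with x hx hx'
    rw [hx, hx']

end walk

omit [DecidableEq V] in
lemma measurable_restr {S T : Finset V} (h : S ⊆ T) : Measurable (restr (J := J) S T h) :=
  measurable_pi_lambda _ fun _ => measurable_pi_apply _

lemma sigmaFinite_of_lintegral_ne_top {α : Type*} [MeasurableSpace α] {ρ : Measure α}
    {f : α → ℝ≥0∞} (hf : Measurable f) (h0 : ∀ x, f x ≠ 0) (htop : ∀ x, f x ≠ ∞)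
    (hint : ∫⁻ x, f x ∂ρ ≠ ∞) : SigmaFinite ρ := by
  rw [← withDensity_inv_same (μ := ρ) hf (ae_of_all _ h0) (ae_of_all _ htop)]
  have : IsFiniteMeasure (ρ.withDensity f) := isFiniteMeasure_withDensity hint
  exact SigmaFinite.withDensity_of_ne_top (ae_of_all _ fun x => ENNReal.inv_ne_top.2 (h0 x))

section family

variable [StandardBorelSpace J] [Nonempty J] {π : Measure J} [IsProbabilityMeasure π]
  {P : Kernel J J} [IsMarkovKernel P] {G : SimpleGraph V} [DecidableRel G.Adj] [Fintype V]

lemma exists_lintegral_listMeasure_ne_top {l : List V} (hl : l.Nodup) :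
    ∃ φ : (V → J) → ℝ≥0∞, Measurable φ ∧ (∀ x x', (∀ w ∈ l, x w = x' w) → φ x = φ x') ∧
      (∀ x, φ x ≠ 0) ∧ (∀ x, φ x ≠ ∞) ∧ ∫⁻ x, φ x ∂(listMeasure π P G l) ≠ ∞ := by
  induction l with
  | nil => exact ⟨fun _ => 1, measurable_const, by simp, by simp, by simp,
      by simp [listMeasure_nil]⟩
  | cons u l ih =>
    obtain ⟨hu, hl⟩ := List.nodup_cons.1 hl
    obtain ⟨φ, hφ, hφl, h0, htop, hint⟩ := ih hl
    have hnu : u ∉ nbrs G u l.toFinset := fun h => G.irrefl (mem_nbrs.1 h).2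
    set c : (V → J) → ℝ≥0∞ := fun x => localKernel π P (nbrs G u l.toFinset) x Set.univ with hc
    have hcm : Measurable c := Kernel.measurable_coe _ MeasurableSet.univ
    have hm : Measurable fun x => φ x * (1 + c x)⁻¹ := hφ.mul (measurable_const.add hcm).inv
    refine ⟨fun x => φ x * (1 + c x)⁻¹, hm, fun x x' hx => ?_, fun x => ?_, fun x => ?_, ?_⟩
    · simp only [hc]
      rw [hφl x x' fun w hw => hx w (.tail _ hw), localKernel_congr fun w hw => hx w
        (.tail _ (List.mem_toFinset.1 (mem_nbrs.1 hw).1))]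
    · exact mul_ne_zero (h0 x) (ENNReal.inv_ne_zero.2
        (ENNReal.add_ne_top.2 ⟨ENNReal.one_ne_top, localKernel_univ_ne_top _ _ _ _⟩))
    · exact ENNReal.mul_ne_top (htop x) (ENNReal.inv_ne_top.2 (by simp))
    · rw [listMeasure_cons, Measure.lintegral_bind (Kernel.aemeasurable _) hm.aemeasurable]
      refine ne_top_of_le_ne_top hint (lintegral_mono fun x => ?_)
      rw [lintegral_step _ _ _ _ _ _ hm]
      have h1 : ∀ a, φ (Function.update x u a) = φ x := fun a =>
        hφl _ _ fun w hw => Function.update_of_ne (ne_of_mem_of_not_mem hw hu) _ _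
      have h2 : ∀ a, c (Function.update x u a) = c x := fun a => by
        simp only [hc]
        rw [localKernel_congr fun w hw =>
          Function.update_of_ne (ne_of_mem_of_not_mem hw hnu) _ _]
      simp only [h1, h2, lintegral_const]
      rw [mul_assoc]
      refine mul_le_of_le_one_right' ?_
      rw [mul_comm, ← div_eq_mul_inv]
      exact ENNReal.div_le_of_le_mul (by rw [one_mul]; exact le_add_self)

variable (π P G) in
/-- The measure on the configurations on `S`: the law of values drawn one after another. -/
noncomputable def homMeasure (S : Finset V) : Measure (S → J) :=
  (listMeasure π P G S.toList).map S.restrict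

instance (S : Finset V) : SigmaFinite (homMeasure π P G S) := by
  obtain ⟨φ, hφ, hφS, h0, htop, hint⟩ :=
    exists_lintegral_listMeasure_ne_top (π := π) (P := P) (G := G) S.nodup_toList
  obtain ⟨j₀⟩ : Nonempty J := inferInstance
  have hm := hφ.comp (measurable_extendConst (V := V) j₀ S)
  refine sigmaFinite_of_lintegral_ne_top hm (fun z => h0 _) (fun z => htop _) ?_
  rw [homMeasure, lintegral_map hm (Finset.measurable_restrict S)]
  refine ne_of_eq_of_ne (lintegral_congr fun x => hφS _ _ fun w hw => ?_) hint
  exact extendConst_restrict_of_mem j₀ x (mem_toList.1 hw)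

lemma homMeasure_singleton {k : ℕ} (h : KLoose π P k) (v : V) :
    homMeasure π P G {v} = π.map fun j (_ : ↥({v} : Finset V)) => j := by
  rw [homMeasure, toList_singleton, listMeasure_of_independent h (by simp)]
  conv_rhs => rw [← (measurePreserving_eval (fun _ : V => π) v).map_eq,
    Measure.map_map (by fun_prop) (by fun_prop)]
  congr 1
  ext x ⟨w, hw⟩
  obtain rfl := mem_singleton.1 hw
  rfl

lemma map_step_pi_of_adj {k : ℕ} (h : SequentiallyLoose π P G k) {u v : V} (huv : G.Adj u v) :
    (step π P G {u} v ∘ₘ Measure.pi fun _ : V => π).map (fun x => (x u, x v)) = π ⊗ₘ P := by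
  have hN : nbrs G v {u} = {u} := by
    ext w
    simp only [mem_nbrs, mem_singleton, and_iff_left_iff_imp]
    rintro rfl
    exact huv.symm
  symm
  refine Measure.ext_prod fun {A B} hA hB => ?_
  have hm : Measurable fun x : V → J => (x u, x v) := by fun_prop
  have hmAB := hm (hA.prod hB)
  rw [Measure.map_apply hm (hA.prod hB), ← lintegral_indicator_one hmAB,
    Measure.lintegral_bind (Kernel.aemeasurable _) (measurable_one.indicator hmAB).aemeasurable]
  simp only [lintegral_step _ _ _ _ _ _ (measurable_one.indicator hmAB), hN]
  have hind : ∀ (x : V → J) a, ((fun x : V → J => (x u, x v)) ⁻¹' A ×ˢ B).indicator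
      (1 : (V → J) → ℝ≥0∞) (Function.update x v a) = A.indicator 1 (x u) * B.indicator 1 a := by
    intro x a
    have hux : Function.update x v a u = x u := Function.update_of_ne huv.ne _ _
    by_cases h1 : x u ∈ A <;> by_cases h2 : a ∈ B <;> simp [h1, h2, hux, Set.indicator]
  have key := lintegral_localKernel h.loose (N := {u}) (by rw [← hN]; exact h.card_nbrs_le _ _)
    (g := fun _ => A.indicator 1) (fun _ => measurable_one.indicator hA)
    (F := fun _ a => B.indicator 1 a)
    ((measurable_one.indicator hB).comp measurable_snd) (fun _ _ _ _ => rfl)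
  simp only [prod_singleton, lintegral_const, measure_univ, mul_one] at key
  have hB1 : Measurable (B.indicator (1 : J → ℝ≥0∞)) := measurable_one.indicator hB
  simp only [hind, lintegral_const_mul _ hB1, key]
  rw [← h.reversible, Measure.map_apply measurable_swap (hA.prod hB), Set.preimage_swap_prod,
    Measure.compProd_apply_prod hB hA, ← lintegral_indicator hB]
  refine lintegral_congr fun a => ?_
  rw [lintegral_indicator_one hA]
  by_cases ha : a ∈ B <;> simp [ha]

lemma homMeasure_pair {k : ℕ} (h : SequentiallyLoose π P G k) {u v : V} (huv : G.Adj u v) :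
    homMeasure π P G {u, v} =
      (π ⊗ₘ P).map fun q (w : ↥({u, v} : Finset V)) => if (w : V) = u then q.1 else q.2 := by
  have hperm : ({u, v} : Finset V).toList.Perm [v, u] :=
    (toList_insert (by simpa using huv.ne)).trans (by
      rw [toList_singleton]; exact List.Perm.swap _ _ _)
  rw [homMeasure, h.listMeasure_perm (nodup_toList _) hperm, listMeasure_cons,
    listMeasure_of_independent h.loose (by simp), ← map_step_pi_of_adj h huv,
    List.toFinset_cons, List.toFinset_nil, insert_empty_eq]
  rw [Measure.map_map (by
    refine measurable_pi_lambda _ fun w => ?_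
    split_ifs <;> fun_prop) (by fun_prop)]
  congr 1
  ext x ⟨w, hw⟩
  by_cases hwu : w = u
  · subst hwu; simp
  · obtain rfl : w = v := by simpa [hwu] using hw
    simp [hwu]

omit [Fintype V] in
lemma toList_perm_append (S T : Finset V) (hST : S ⊆ T) :
    T.toList.Perm ((T \ S).toList ++ S.toList) := by
  refine (List.perm_ext_iff_of_nodup (nodup_toList _) ?_).2 fun w => ?_
  · exact List.nodup_append.2 ⟨nodup_toList _, nodup_toList _, fun a ha b hb hab =>
      (mem_sdiff.1 (mem_toList.1 ha)).2 (hab ▸ mem_toList.1 hb)⟩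
  · simp only [List.mem_append, mem_toList, mem_sdiff]
    have := @hST w
    tauto

lemma listMeasure_toList_eq {k : ℕ} (h : SequentiallyLoose π P G k) {S T : Finset V}
    (hST : S ⊆ T) : listMeasure π P G T.toList =
      walk π P G S (T \ S).toList ∘ₘ listMeasure π P G S.toList := by
  rw [h.listMeasure_perm (nodup_toList _) (toList_perm_append S T hST), listMeasure_append,
    toList_toFinset]

lemma map_restr_homMeasure_absolutelyContinuous {k : ℕ} (h : SequentiallyLoose π P G k)
    {S T : Finset V} (hST : S ⊆ T) :
    (homMeasure π P G T).map (restr S T hST) ≪ homMeasure π P G S := by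
  have hm := measurable_restr (J := J) hST
  have : restr (J := J) S T hST ∘ T.restrict (π := fun _ : V => J) = S.restrict := rfl
  rw [homMeasure, Measure.map_map hm (Finset.measurable_restrict T), this,
    h.listMeasure_perm (nodup_toList _) (toList_perm_append S T hST)]
  exact map_restrict_listMeasure_append (by simp)

variable (π P G) in
/-- The law of the values at `T \ S` given the values on `S`; the constant `j₀` plays no role. -/
noncomputable def homKernel (j₀ : J) (S T : Finset V) : Kernel (S → J) (↥(T \ S) → J) :=
  ((walk π P G S (T \ S).toList).comap (extendConst j₀ S) (measurable_extendConst j₀ S)).map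
    (T \ S).restrict

omit [Fintype V] in
lemma homKernel_apply (j₀ : J) (S T : Finset V) (x : S → J) :
    homKernel π P G j₀ S T x =
      (walk π P G S (T \ S).toList (extendConst j₀ S x)).map (T \ S).restrict := by
  rw [homKernel, Kernel.map_apply _ (Finset.measurable_restrict _), Kernel.comap_apply]

omit [MeasurableSpace J] [StandardBorelSpace J] [Nonempty J] [Fintype V] in
lemma restrict_overwrite_of_disjoint {S : Finset V} {l : List V} (h : ∀ w ∈ S, w ∉ l)
    (x z : V → J) : S.restrict (overwrite l x z) = S.restrict x :=
  funext fun w => overwrite_of_notMem (h w w.2) x z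

omit [MeasurableSpace J] [StandardBorelSpace J] [Nonempty J] [Fintype V] in
lemma restrict_overwrite_of_subset {S : Finset V} {l : List V} (h : ∀ w ∈ S, w ∈ l)
    (x z : V → J) : S.restrict (overwrite l x z) = S.restrict z :=
  funext fun w => overwrite_of_mem (h w w.2) x z

lemma homMeasure_apply_restr {k : ℕ} (h : SequentiallyLoose π P G k) (j₀ : J) {S T : Finset V}
    (hST : S ⊆ T) {A : Set (S → J)} {B : Set (↥(T \ S) → J)} (hA : MeasurableSet A)
    (hB : MeasurableSet B) :
    homMeasure π P G T {x | restr S T hST x ∈ A ∧ restr (T \ S) T sdiff_subset x ∈ B} =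
      ∫⁻ x in A, homKernel π P G j₀ S T x B ∂(homMeasure π P G S) := by
  have hrS := Finset.measurable_restrict (X := fun _ : V => J) S
  have hrD := Finset.measurable_restrict (X := fun _ : V => J) (T \ S)
  have hrT := Finset.measurable_restrict (X := fun _ : V => J) T
  have hset : MeasurableSet
      {x : T → J | restr S T hST x ∈ A ∧ restr (T \ S) T sdiff_subset x ∈ B} :=
    (measurable_restr hST hA).inter (measurable_restr sdiff_subset hB)
  rw [homMeasure, homMeasure, Measure.map_apply hrT hset, listMeasure_toList_eq h hST,
    Measure.bind_apply (hrT hset) (Kernel.aemeasurable _),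
    setLIntegral_map hA (Kernel.measurable_coe _ hB) hrS, ← lintegral_indicator (hrS hA)]
  refine lintegral_congr fun x => ?_
  have hS : ∀ w ∈ S, w ∉ (T \ S).toList := by simp +contextual
  by_cases hx : S.restrict x ∈ A
  · rw [Set.indicator_of_mem (show x ∈ S.restrict ⁻¹' A from hx), homKernel_apply,
      Measure.map_apply hrD hB, ← lintegral_indicator_one (hrT hset),
      ← lintegral_indicator_one (hrD hB)]
    refine lintegral_walk_congr (measurable_one.indicator (hrT hset))
      (measurable_one.indicator (hrD hB))
      (fun w hw => (extendConst_restrict_of_mem j₀ x hw).symm) fun z => ?_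
    refine Set.indicator_eq_indicator ?_ rfl
    change (S.restrict (overwrite (T \ S).toList x z) ∈ A ∧
      (T \ S).restrict (overwrite (T \ S).toList x z) ∈ B) ↔
        (T \ S).restrict (overwrite (T \ S).toList _ z) ∈ B
    rw [restrict_overwrite_of_disjoint hS, restrict_overwrite_of_subset (by simp),
      restrict_overwrite_of_subset (by simp)]
    exact and_iff_right hx
  · rw [Set.indicator_of_notMem (show x ∉ S.restrict ⁻¹' A from hx)]
    refine walk_apply_eq_zero (hrT hset) fun z hz => hx ?_
    have : S.restrict (overwrite (T \ S).toList x z) ∈ A := hz.1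
    rwa [restrict_overwrite_of_disjoint hS] at this

omit [Fintype V] in
lemma walk_union_of_not_adj {S A : Finset V} {l : List V} (h : ∀ u ∈ l, ∀ a ∈ A, ¬ G.Adj u a) :
    walk π P G (S ∪ A) l = walk π P G S l := by
  induction l with
  | nil => rfl
  | cons u l ih =>
    have hN : nbrs G u (S ∪ A ∪ l.toFinset) = nbrs G u (S ∪ l.toFinset) := by
      ext w
      have := h u (.head _) w
      simp only [mem_nbrs, mem_union]
      tauto
    rw [walk_cons, walk_cons, ih fun v hv => h v (.tail _ hv), step, hN, step]

omit [Fintype V] in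
lemma map_walk_append_of_not_adj {S A B : Finset V} (hSA : Disjoint S A)
    (hAB : Disjoint A B) (h : ∀ a ∈ A, ∀ b ∈ B, ¬ G.Adj a b) (x : V → J) :
    (walk π P G S (B.toList ++ A.toList) x).map (fun y => (A.restrict y, B.restrict y)) =
      ((walk π P G S A.toList x).map A.restrict).prod
        ((walk π P G S B.toList x).map B.restrict) := by
  have hrA := Finset.measurable_restrict (X := fun _ : V => J) A
  have hrB := Finset.measurable_restrict (X := fun _ : V => J) B
  refine Measure.ext_of_lintegral _ fun f hf => ?_
  have hfAB : Measurable fun y : V → J => f (A.restrict y, B.restrict y) :=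
    hf.comp (hrA.prodMk hrB)
  have hf₂ : Measurable fun p : (V → J) × (V → J) => f (A.restrict p.1, B.restrict p.2) :=
    hf.comp ((hrA.comp measurable_fst).prodMk (hrB.comp measurable_snd))
  rw [lintegral_map hf (hrA.prodMk hrB), walk_append, toList_toFinset,
    walk_union_of_not_adj (fun b hb a ha hba => h a ha b (mem_toList.1 hb) hba.symm),
    Kernel.lintegral_comp _ _ _ hfAB, lintegral_prod _ hf.aemeasurable,
    lintegral_map (hf.lintegral_prod_right') hrA]
  have hmap : ∀ c, ∫⁻ b, f (c, b) ∂((walk π P G S B.toList x).map B.restrict) =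
      ∫⁻ y, f (c, B.restrict y) ∂(walk π P G S B.toList x) :=
    fun c => lintegral_map (f := fun b => f (c, b)) (hf.comp measurable_prodMk_left) hrB
  simp only [hmap]
  refine lintegral_walk_congr hfAB.lintegral_kernel hf₂.lintegral_prod_right' (fun _ _ => rfl)
    fun z => ?_
  refine lintegral_walk_congr hfAB (hf₂.comp measurable_prodMk_left) (fun w hw => ?_) fun z' => ?_
  · exact overwrite_of_notMem (fun hw' => Finset.disjoint_left.1 hSA hw (mem_toList.1 hw')) _ _
  · rw [restrict_overwrite_of_disjoint (S := A)
        (fun w hw hw' => Finset.disjoint_left.1 hAB hw (mem_toList.1 hw')),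
      restrict_overwrite_of_subset (S := B) (by simp),
      restrict_overwrite_of_subset (S := B) (by simp)]

omit [Fintype V] in
lemma sdiff_union_toList_perm {S U W : Finset V} (hUW : Disjoint (U \ S) (W \ S)) :
    ((U ∪ W) \ S).toList.Perm ((W \ S).toList ++ (U \ S).toList) := by
  refine (List.perm_ext_iff_of_nodup (nodup_toList _) ?_).2 fun w => ?_
  · exact List.nodup_append.2 ⟨nodup_toList _, nodup_toList _, fun a ha b hb hab =>
      Finset.disjoint_left.1 hUW (mem_toList.1 hb) (hab ▸ mem_toList.1 ha)⟩
  · simp only [List.mem_append, mem_toList, mem_sdiff, mem_union]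
    tauto

lemma homKernel_ae_eq_prod {k : ℕ} (h : SequentiallyLoose π P G k) (j₀ : J) (U W : Finset V)
    (hUW : ∀ u ∈ U \ (U ∩ W), ∀ w ∈ W \ (U ∩ W), ¬ G.Adj u w) :
    ∀ᵐ x ∂(homMeasure π P G (U ∩ W)),
      (homKernel π P G j₀ (U ∩ W) (U ∪ W) x).map
          (fun y => (restr (U \ (U ∩ W)) ((U ∪ W) \ (U ∩ W))
                        (sdiff_subset_sdiff subset_union_left le_rfl) y,
                     restr (W \ (U ∩ W)) ((U ∪ W) \ (U ∩ W))
                        (sdiff_subset_sdiff subset_union_right le_rfl) y)) =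
        (homKernel π P G j₀ (U ∩ W) U x).prod (homKernel π P G j₀ (U ∩ W) W x) := by
  have hdisj : Disjoint (U \ (U ∩ W)) (W \ (U ∩ W)) := by
    rw [Finset.disjoint_left]
    simp only [mem_sdiff, mem_inter]
    tauto
  have hem := measurable_extendConst (V := V) j₀ (U ∩ W)
  have hρ : ((homMeasure π P G (U ∩ W)).map (extendConst j₀ (U ∩ W))).map
      (U ∩ W).restrict = homMeasure π P G (U ∩ W) := by
    rw [Measure.map_map (Finset.measurable_restrict _) hem]
    convert Measure.map_id using 2
    exact funext (restrict_extendConst j₀)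
  have hnd : ((((U ∪ W) \ (U ∩ W)).toList) ++ (U ∩ W).toList).Nodup :=
    (toList_perm_append _ _ inter_subset_union).nodup_iff.1 (nodup_toList _)
  have hae := h.walk_perm hnd (sdiff_union_toList_perm hdisj)
    (ρ := (homMeasure π P G (U ∩ W)).map (extendConst j₀ (U ∩ W)))
    (by rw [toList_toFinset, hρ, homMeasure])
  rw [toList_toFinset] at hae
  filter_upwards [ae_of_ae_map hem.aemeasurable hae] with x hx
  rw [homKernel_apply, homKernel_apply, homKernel_apply,
    Measure.map_map ((measurable_restr _).prodMk (measurable_restr _))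
      (Finset.measurable_restrict _), hx]
  exact map_walk_append_of_not_adj disjoint_sdiff hdisj hUW _

/-- In the setting where the values can be drawn in any order, drawing them one after another yields
a normalized, decreasing, Markovian family. -/
theorem SequentiallyLoose.isHomMeasureFamily {k : ℕ} (h : SequentiallyLoose π P G k) :
    IsHomMeasureFamily G (π ⊗ₘ P) (homMeasure π P G) := by
  obtain ⟨j₀⟩ : Nonempty J := inferInstance
  refine ⟨fun _ => inferInstance, fun v => ?_, fun u v huv => homMeasure_pair h huv,
    fun S T hST => map_restr_homMeasure_absolutelyContinuous h hST,
    fun S T _ => homKernel π P G j₀ S T,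
    fun S T hST A B hA hB => homMeasure_apply_restr h j₀ hST hA hB,
    fun U W hUW => homKernel_ae_eq_prod h j₀ U W hUW⟩
  rw [homMeasure_singleton h.loose]
  congr 1
  exact (Measure.fst_compProd π P).symm

end family

/-- **Corollary (girth ≥ 5).**
Let `(J, η)` be a `k`-loose Markov space (with stationary distribution `π = η ∘ fst⁻¹` and
disintegrating Markov kernel `P`).  Then every finite simple graph of girth at least `5`
(no triangles and no 4-cycles) with maximum degree at most `k` is well-measured in `η`. -/
theorem wellMeasured_of_girth_ge_five {V : Type*} [Fintype V] [DecidableEq V]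
    [StandardBorelSpace J]
    (η : Measure (J × J)) [IsProbabilityMeasure η]
    (hsym : η.map Prod.swap = η)
    (P : Kernel J J) [IsMarkovKernel P]
    (hP : ∀ A B : Set J, MeasurableSet A → MeasurableSet B →
      η (A ×ˢ B) = ∫⁻ x in A, P x B ∂(η.map Prod.fst))
    (k : ℕ) (hloose : KLoose (η.map Prod.fst) P k)
    (G : SimpleGraph V) [DecidableRel G.Adj]
    (h3 : G.CliqueFree 3)
    (h4 : ∀ a b c d : V, G.Adj a b → G.Adj b c → G.Adj c d → G.Adj d a → a = c ∨ b = d)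
    (hdeg : ∀ v : V, G.degree v ≤ k) :
    WellMeasured G η := by
  have hη : η.map Prod.fst ⊗ₘ P = η :=
    (Measure.ext_prod fun {A B} hA hB => by
      rw [hP A B hA hB, Measure.compProd_apply_prod hA hB]).symm
  have : IsProbabilityMeasure (η.map Prod.fst) :=
    Measure.isProbabilityMeasure_map measurable_fst.aemeasurable
  have : Nonempty J := (η.map Prod.fst).nonempty_of_neZero
  have h : SequentiallyLoose (η.map Prod.fst) P G k :=
    { loose := hloose
      reversible := by rw [hη, hsym]
      card_nbrs_le := fun v S => (card_le_card fun w hw =>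
        (G.mem_neighborFinset v w).2 (mem_nbrs.1 hw).2).trans (hdeg v)
      triangleFree := fun u v w huv hvw hwu =>
        h3 {u, v, w} (SimpleGraph.is3Clique_triple_iff.2 ⟨huv, hwu.symm, hvw⟩)
      fourCycleFree := h4 }
  have hfam := h.isHomMeasureFamily
  rw [hη] at hfam
  exact ⟨_, hfam⟩
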